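/- Let β : ℝ² → ℂ be a Schwartz function and let u : ℝ² × ℝ → ℂ be 𝕃-periodic in its first variable with u integrable on Ω × ℝ. Then, as ε → 0⁺, ∫_{ℝ²×ℝ} β(εx) u(x,z) dx dz = ε⁻² · (|Ω|⁻¹ ∫_{Ω×ℝ} u(x,z) dx dz) · (∫_{ℝ²} β(X) dX) + O(ε^∞); that is, for every n ∈ ℕ there exist C_n > 0 and ε₀ > 0 such that for all ε ∈ (0, ε₀), the absolute value of the difference between the left-hand side and the first term on the right-hand side is at most C_n ε^n. -/

import Mathlib

noncomputable section

open MeasureTheory Real Complex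

abbrev Pt : Type := ℝ × ℝ

/-- Euclidean dot product on ℝ². -/
def dot (v w : Pt) : ℝ := v.1 * w.1 + v.2 * w.2

/-- The matrix J acting by J(x₁,x₂) = (x₂, −x₁). -/
def Jmat (v : Pt) : Pt := (v.2, -v.1)

/-- Rotation of ℝ² by angle θ. -/
def rotA (θ : ℝ) (v : Pt) : Pt :=
  (Real.cos θ * v.1 - Real.sin θ * v.2, Real.sin θ * v.1 + Real.cos θ * v.2)

/-- Lattice vector a₁ = a₀(1/2, −√3/2). -/
def av1 (a0 : ℝ) : Pt := (a0 / 2, -(Real.sqrt 3 * a0 / 2))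

/-- Lattice vector a₂ = a₀(1/2, √3/2). -/
def av2 (a0 : ℝ) : Pt := (a0 / 2, Real.sqrt 3 * a0 / 2)

/-- The graphene lattice 𝕃 = ℤa₁ + ℤa₂. -/
def lat (a0 : ℝ) : AddSubgroup Pt := AddSubgroup.closure {av1 a0, av2 a0}

/-- The moiré lattice 𝕃_M = J𝕃. -/
def latM (a0 : ℝ) : AddSubgroup Pt := AddSubgroup.closure {Jmat (av1 a0), Jmat (av2 a0)}

/-- Dual basis vector a₁*. -/
def as1 (a0 : ℝ) : Pt := (2 * π / a0, -(2 * π / (Real.sqrt 3 * a0)))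

/-- Dual basis vector a₂*. -/
def as2 (a0 : ℝ) : Pt := (2 * π / a0, 2 * π / (Real.sqrt 3 * a0))

/-- The Dirac point K = (a₁* + a₂*)/3. -/
def Kpt (a0 : ℝ) : Pt := (3 : ℝ)⁻¹ • (as1 a0 + as2 a0)

/-- A dual lattice vector G = m₁a₁* + m₂a₂*. -/
def dualVec (a0 : ℝ) (m : ℤ × ℤ) : Pt := (m.1 : ℝ) • as1 a0 + (m.2 : ℝ) • as2 a0

/-- 𝕃-periodicity in the first variable. -/
def LPeriodic (a0 : ℝ) (f : Pt → ℝ → ℂ) : Prop :=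
  ∀ R ∈ lat a0, ∀ (x : Pt) (z : ℝ), f (x + R) z = f x z

/-- K-quasiperiodicity in the first variable. -/
def KQuasiperiodic (a0 : ℝ) (Φ : Pt → ℝ → ℂ) : Prop :=
  ∀ R ∈ lat a0, ∀ (x : Pt) (z : ℝ),
    Φ (x + R) z = Complex.exp (Complex.I * (dot (Kpt a0) R : ℂ)) * Φ x z

/-- ω = e^{2πi/3}. -/
def ωc : ℂ := Complex.exp (2 * Real.pi * Complex.I / 3)

/-- The integrand of ((f,g))_d^{ηη'}(X). -/
def braFn (d η η' : ℝ) (f g : Pt → ℝ → ℂ) (X : Pt) (p : Pt × ℝ) : ℂ :=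
  (starRingEnd ℂ) (f (p.1 - (η / 2) • Jmat X) (p.2 - η * d / 2)) *
    g (p.1 - (η' / 2) • Jmat X) (p.2 - η' * d / 2)

/-- ((f,g))_d^{ηη'}(X), the interlayer pairing. -/
def bra (d : ℝ) (Ω : Set Pt) (η η' : ℝ) (f g : Pt → ℝ → ℂ) (X : Pt) : ℂ :=
  ∫ p in Ω ×ˢ (Set.univ : Set ℝ), braFn d η η' f g X p

namespace TwoScale

open Module Submodule
open scoped Pointwise

section Unfolding

variable {G α : Type*} [AddGroup G] [Countable G] [MeasurableSpace α] [AddAction G α]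
  [MeasurableConstVAdd G α]

theorem measurable_tsum_vadd {φ : α → ℂ} (hφ : Measurable φ)
    (hsum : ∀ x, Summable fun g : G => ‖φ (g +ᵥ x)‖) :
    Measurable fun x => ∑' g : G, φ (g +ᵥ x) := by
  refine measurable_of_tendsto_metrizable' (Filter.atTop : Filter (Finset G))
    (f := fun s x => ∑ g ∈ s, φ (g +ᵥ x)) (fun s => ?_) ?_
  · exact Finset.measurable_sum _ fun g _ => hφ.comp (measurable_const_vadd g)
  · rw [tendsto_pi_nhds]
    exact fun x => (hsum x).of_norm.hasSum

/-- Unfolding: integrating the product of a function with uniformly summable translates and an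
invariant function reduces to an integral over a fundamental domain. -/
theorem integral_mul_eq_setIntegral_tsum {μ : Measure α} [VAddInvariantMeasure G α μ] {D : Set α}
    (h : IsAddFundamentalDomain G D μ) {φ u : α → ℂ} (hφ : Measurable φ) {B : ℝ}
    (hsum : ∀ x, Summable fun g : G => ‖φ (g +ᵥ x)‖)
    (hB : ∀ x, ∑' g : G, ‖φ (g +ᵥ x)‖ ≤ B)
    (hu : ∀ (g : G) x, u (g +ᵥ x) = u x) (hint : IntegrableOn u D μ) :
    ∫ x, φ x * u x ∂μ = ∫ x in D, (∑' g : G, φ (g +ᵥ x)) * u x ∂μ := by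
  have hle (s : Finset G) (x : α) : ∑ g ∈ s, ‖φ (g +ᵥ x)‖ ≤ B :=
    ((hsum x).sum_le_tsum s fun _ _ => norm_nonneg _).trans (hB x)
  have hi (g : G) : IntegrableOn (fun x => φ (g +ᵥ x) * u x) D μ := by
    refine hint.bdd_mul (c := B) (hφ.comp (measurable_const_vadd g)).aestronglyMeasurable
      (.of_forall fun x => ?_)
    simpa using hle {g} x
  have hs : Summable fun g : G => ∫ x in D, ‖φ (g +ᵥ x) * u x‖ ∂μ := by
    refine summable_of_sum_le (c := ∫ x in D, B * ‖u x‖ ∂μ)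
      (fun g => integral_nonneg fun _ => norm_nonneg _) fun s => ?_
    rw [← integral_finsetSum _ fun g _ => (hi g).norm]
    refine integral_mono (integrable_finsetSum _ fun g _ => (hi g).norm)
      (hint.norm.const_mul B) fun x => ?_
    simp only [norm_mul, ← Finset.sum_mul]
    exact mul_le_mul_of_nonneg_right (hle s x) (norm_nonneg _)
  have hmp (g : G) := measurePreserving_vadd g μ
  have himg (g : G) : g +ᵥ D = (fun x => g +ᵥ x) '' D := rfl
  have hf : Integrable (fun x => φ x * u x) μ := by
    rw [← integrableOn_univ]
    refine IntegrableOn.congr_set_ae ?_ h.iUnion_vadd_ae_eq.symm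
    refine integrableOn_iUnion_of_summable_integral_norm (fun g => ?_) ?_
    · rw [himg, (hmp g).integrableOn_image (measurableEmbedding_const_vadd g)]
      simpa [Function.comp_def, hu] using hi g
    · refine hs.congr fun g => ?_
      rw [himg, (hmp g).setIntegral_image_emb (measurableEmbedding_const_vadd g)]
      simp [hu]
  rw [h.integral_eq_tsum'' _ hf]
  simp only [hu]
  rw [integral_tsum_of_summable_integral_norm hi hs]
  simp [tsum_mul_right]

end Unfolding

section Periodization

variable {E ι : Type*} [NormedAddCommGroup E] [NormedSpace ℝ E] [Fintype ι] (b : Basis ι ℝ E)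

/-- The lattice of integer combinations of the basis `b`. -/
abbrev basisLattice : AddSubgroup E := (span ℤ (Set.range b)).toAddSubgroup

instance countable_basisLattice : Countable (basisLattice b) :=
  inferInstanceAs (Countable (span ℤ (Set.range b)))

theorem exists_lattice_add_norm_le (x : E) :
    ∃ R : basisLattice b, ‖(R : E) + x‖ ≤ ∑ i, ‖b i‖ := by
  refine ⟨⟨-(ZSpan.floor b x : E), neg_mem (ZSpan.floor b x).2⟩, ?_⟩
  have := ZSpan.norm_fract_le b x
  rw [ZSpan.fract_apply] at this
  rwa [neg_add_eq_sub]

omit [NormedSpace ℝ E] in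
theorem inv_one_add_norm_pow_le {x y : E} {r : ℝ} (hx : ‖x‖ ≤ r) (k : ℕ) :
    ((1 + ‖y + x‖) ^ k)⁻¹ ≤ (1 + r) ^ k * ((1 + ‖y‖) ^ k)⁻¹ := by
  have hr : 0 ≤ r := (norm_nonneg x).trans hx
  rw [← div_eq_mul_inv, le_div_iff₀ (by positivity), inv_mul_le_iff₀ (by positivity), ← mul_pow]
  gcongr
  have := norm_sub_le (y + x) x
  rw [add_sub_cancel_right] at this
  nlinarith [norm_nonneg (y + x)]

theorem summable_inv_one_add_norm_pow [FiniteDimensional ℝ E] {k : ℕ}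
    (hk : finrank ℝ E < k) : Summable fun R : basisLattice b => ((1 + ‖(R : E)‖) ^ k)⁻¹ := by
  have h1 : Summable fun R : span ℤ (Set.range b) => ‖R‖⁻¹ ^ k :=
    ZLattice.summable_norm_pow_inv _ k (by rwa [ZLattice.rank ℝ])
  have h2 : Summable fun R : span ℤ (Set.range b) => ((1 + ‖R‖) ^ k)⁻¹ := by
    refine h1.of_norm_bounded_eventually ((Set.finite_singleton 0).subset fun R hR => ?_)
    by_contra h
    have h0 : 0 < ‖R‖ := norm_pos_iff.2 h
    refine hR (?_ : ‖((1 + ‖R‖) ^ k)⁻¹‖ ≤ ‖R‖⁻¹ ^ k)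
    rw [Real.norm_of_nonneg (by positivity), inv_pow]
    gcongr
    simp
  exact h2

theorem exists_tsum_inv_one_add_norm_pow_le [FiniteDimensional ℝ E] {k : ℕ}
    (hk : finrank ℝ E < k) : ∃ M : ℝ, ∀ x : E,
      Summable (fun R : basisLattice b => ((1 + ‖(R : E) + x‖) ^ k)⁻¹) ∧
      ∑' R : basisLattice b, ((1 + ‖(R : E) + x‖) ^ k)⁻¹ ≤ M := by
  set r := ∑ i, ‖b i‖
  have hs := (summable_inv_one_add_norm_pow b hk).mul_left ((1 + r) ^ k)
  refine ⟨∑' R : basisLattice b, (1 + r) ^ k * ((1 + ‖(R : E)‖) ^ k)⁻¹, fun x => ?_⟩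
  obtain ⟨S, hS⟩ := exists_lattice_add_norm_le b x
  have hb (R : basisLattice b) := inv_one_add_norm_pow_le (y := (R : E)) hS k
  have h1 : Summable fun R : basisLattice b => ((1 + ‖(R : E) + (S + x)‖) ^ k)⁻¹ :=
    .of_nonneg_of_le (fun R => by positivity) hb hs
  have h2 := h1.tsum_le_tsum hb hs
  have he : (fun R : basisLattice b => ((1 + ‖(R : E) + (S + x)‖) ^ k)⁻¹) =
      (fun R : basisLattice b => ((1 + ‖(R : E) + x‖) ^ k)⁻¹) ∘ Equiv.addRight S := by
    ext R
    simp [add_assoc]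
  rw [he] at h1 h2
  exact ⟨(Equiv.addRight S).summable_iff.1 h1, ((Equiv.addRight S).tsum_eq _).symm.trans_le h2⟩

/-- Sum over the lattice spanned by `b` of the translates of `x ↦ γ (ε • x)`. -/
def periodize (γ : SchwartzMap E ℂ) (ε : ℝ) (x : E) : ℂ :=
  ∑' R : basisLattice b, γ (ε • ((R : E) + x))

omit [Fintype ι] in
theorem periodize_lattice_add (γ : SchwartzMap E ℂ) (ε : ℝ) (R : basisLattice b) (x : E) :
    periodize b γ ε (R + x) = periodize b γ ε x := by
  rw [periodize, periodize,
    ← (Equiv.addRight R).tsum_eq fun S : basisLattice b => γ (ε • ((S : E) + x))]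
  simp [add_assoc]

theorem exists_norm_comp_smul_le (γ : SchwartzMap E ℂ) (k : ℕ) :
    ∃ C : ℝ, 0 < C ∧ ∀ ε : ℝ, 0 < ε → ε < 1 → ∀ y : E,
      ‖γ (ε • y)‖ ≤ C * (ε ^ k)⁻¹ * ((1 + ‖y‖) ^ k)⁻¹ := by
  have h := SchwartzMap.one_add_le_sup_seminorm_apply (𝕜 := ℝ) (m := (k, 0)) le_rfl le_rfl γ
  simp only [norm_iteratedFDeriv_zero] at h
  refine ⟨2 ^ k * ((Finset.Iic (k, 0)).sup fun m => SchwartzMap.seminorm ℝ m.1 m.2) γ + 1,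
    lt_of_le_of_lt ?_ (lt_add_one _), fun ε h0 h1 y => ?_⟩
  · exact le_trans (by positivity) (h 0)
  · rw [mul_assoc, ← mul_inv, ← mul_pow, ← div_eq_mul_inv, le_div_iff₀ (by positivity), mul_comm]
    refine le_trans ?_ ((h (ε • y)).trans (le_add_of_nonneg_right zero_le_one))
    gcongr
    rw [norm_smul, Real.norm_of_nonneg h0.le]
    linarith

variable [FiniteDimensional ℝ E]

theorem summable_norm_comp_smul (γ : SchwartzMap E ℂ) {ε : ℝ} (h0 : 0 < ε) (h1 : ε < 1) (x : E) :
    Summable fun R : basisLattice b => ‖γ (ε • ((R : E) + x))‖ := by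
  obtain ⟨C, -, hC⟩ := exists_norm_comp_smul_le γ (finrank ℝ E + 1)
  obtain ⟨M, hM⟩ := exists_tsum_inv_one_add_norm_pow_le b (Nat.lt_succ_self (finrank ℝ E))
  exact .of_nonneg_of_le (fun _ => norm_nonneg _) (fun R => hC ε h0 h1 _) ((hM x).1.mul_left _)

theorem exists_tsum_norm_comp_smul_le (γ : SchwartzMap E ℂ) :
    ∃ C : ℝ, 0 < C ∧ ∀ ε : ℝ, 0 < ε → ε < 1 → ∀ x : E,
      ∑' R : basisLattice b, ‖γ (ε • ((R : E) + x))‖ ≤ C * (ε ^ (finrank ℝ E + 1))⁻¹ := by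
  obtain ⟨C, hC0, hC⟩ := exists_norm_comp_smul_le γ (finrank ℝ E + 1)
  obtain ⟨M, hM⟩ := exists_tsum_inv_one_add_norm_pow_le b (Nat.lt_succ_self (finrank ℝ E))
  refine ⟨C * (|M| + 1), by positivity, fun ε h0 h1 x => ?_⟩
  refine ((summable_norm_comp_smul b γ h0 h1 x).tsum_le_tsum (fun R => hC ε h0 h1 _)
    ((hM x).1.mul_left _)).trans ?_
  rw [tsum_mul_left, mul_right_comm]
  gcongr
  exact (hM x).2.trans ((le_abs_self M).trans (by linarith))

open scoped LineDeriv

theorem hasDerivAt_periodize (γ : SchwartzMap E ℂ) {ε : ℝ} (h0 : 0 < ε) (h1 : ε < 1)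
    (x : E) (c : ι → ℝ) (t : ℝ) :
    HasDerivAt (fun t : ℝ => periodize b γ ε (x + t • ∑ i, c i • b i))
      (∑ i, (ε * c i) • periodize b (∂_{b i} γ : SchwartzMap E ℂ) ε (x + t • ∑ i, c i • b i)) t := by
  set v := ∑ i, c i • b i with hv
  set k := finrank ℝ E + 1
  choose C hC0 hC using fun i => exists_norm_comp_smul_le (∂_{b i} γ : SchwartzMap E ℂ) k
  have hsum (i : ι) (s : ℝ) : Summable fun R : basisLattice b => (ε * c i) •
      (∂_{b i} γ : SchwartzMap E ℂ) (ε • ((R : E) + (x + s • v))) :=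
    ((summable_norm_comp_smul b (∂_{b i} γ : SchwartzMap E ℂ) h0 h1 _).of_norm).const_smul _
  set r := ‖x‖ + (|t| + 1) * ‖v‖
  have key := hasDerivAt_tsum_of_isPreconnected (𝕜 := ℝ) (t := Metric.ball t 1) (y₀ := t) (y := t)
    (g := fun (R : basisLattice b) (s : ℝ) => γ (ε • ((R : E) + (x + s • v))))
    (g' := fun (R : basisLattice b) (s : ℝ) => ∑ i, (ε * c i) • (∂_{b i} γ : SchwartzMap E ℂ) (ε • ((R : E) + (x + s • v))))
    (u := fun R : basisLattice b => ∑ i, |ε * c i| * (C i * (ε ^ k)⁻¹ *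
      ((1 + r) ^ k * ((1 + ‖(R : E)‖) ^ k)⁻¹)))
    ?_ Metric.isOpen_ball (convex_ball t 1).isPreconnected ?_ ?_ (Metric.mem_ball_self one_pos)
    (summable_norm_comp_smul b γ h0 h1 _).of_norm (Metric.mem_ball_self one_pos)
  · rw [Summable.tsum_finsetSum fun i _ => hsum i t] at key
    simpa only [tsum_const_smul''] using! key
  · refine summable_sum fun i _ => ?_
    exact (((summable_inv_one_add_norm_pow b (Nat.lt_succ_self _)).mul_left _).mul_left _).mul_left _
  · intro R s _
    have hγ := (γ.hasFDerivAt (ε • ((R : E) + (x + s • v)))).comp_hasDerivAt s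
      ((((((hasDerivAt_id s).smul_const v).const_add x).const_add (R : E)).const_smul ε))
    convert! hγ using 1
    simp [SchwartzMap.lineDerivOp_apply_eq_fderiv, hv, Finset.mul_sum, mul_assoc]
  · intro R s hs
    refine (norm_sum_le _ _).trans (Finset.sum_le_sum fun i _ => ?_)
    rw [norm_smul, Real.norm_eq_abs]
    refine mul_le_mul_of_nonneg_left ((hC i ε h0 h1 _).trans ?_) (abs_nonneg _)
    have := (hC0 i).le
    refine mul_le_mul_of_nonneg_left (inv_one_add_norm_pow_le ?_ k) (by positivity)
    refine (norm_add_le _ _).trans ?_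
    rw [norm_smul, Real.norm_eq_abs]
    have : |s| ≤ |t| + 1 := by
      rw [Metric.mem_ball, Real.dist_eq] at hs
      have := abs_sub_abs_le_abs_sub s t
      linarith
    exact add_le_add_right (mul_le_mul_of_nonneg_right this (norm_nonneg v)) _

theorem exists_norm_periodize_sub_le (γ : SchwartzMap E ℂ) {ε : ℝ} (h0 : 0 < ε) (h1 : ε < 1)
    {K : ι → ℝ} (hK : ∀ i x, ‖periodize b (∂_{b i} γ : SchwartzMap E ℂ) ε x‖ ≤ K i) (x y : E) :
    ‖periodize b γ ε x - periodize b γ ε y‖ ≤ ε * ∑ i, K i := by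
  set v := ZSpan.fract b (x - y) with hv
  have hx : periodize b γ ε x = periodize b γ ε (y + v) := by
    rw [← periodize_lattice_add b γ ε (ZSpan.floor b (x - y)) (y + v), hv, ZSpan.fract_apply]
    congr 1
    abel
  have hvs : ∑ i, Int.fract (b.repr (x - y) i) • b i = v := by
    rw [← b.sum_repr v]
    simp [hv, ZSpan.repr_fract_apply]
  have key := norm_image_sub_le_of_norm_deriv_le_segment_01' (C := ε * ∑ i, K i)
    (fun t _ => (hasDerivAt_periodize b γ h0 h1 y
      (fun i => Int.fract (b.repr (x - y) i)) t).hasDerivWithinAt) fun t _ => ?_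
  · simp only [hvs, one_smul, zero_smul, add_zero] at key
    rwa [hx]
  · rw [Finset.mul_sum]
    refine (norm_sum_le _ _).trans (Finset.sum_le_sum fun i _ => ?_)
    rw [norm_smul, Real.norm_eq_abs, abs_mul, abs_of_pos h0, Int.abs_fract, mul_assoc]
    refine mul_le_mul_of_nonneg_left ?_ h0.le
    exact (mul_le_of_le_one_left (norm_nonneg _) (Int.fract_lt_one _).le).trans (hK i _)

variable [MeasurableSpace E] [BorelSpace E] (μ : Measure E) [μ.IsAddHaarMeasure]

theorem integral_lineDerivOp_eq_zero (γ : SchwartzMap E ℂ) (v : E) : ∫ x, ∂_{v} γ x ∂μ = 0 := by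
  set δ : SchwartzMap E ℂ := ∂_{v} γ
  have := integral_bilinear_hasLineDerivAt_right_eq_neg_left_of_integrable (μ := μ)
    (f := fun _ : E => (1 : ℂ)) (f' := fun _ => 0) (g := γ) (g' := δ) (v := v)
    (B := ContinuousLinearMap.mul ℝ ℂ) (by simp)
    (by simpa using δ.integrable) (by simpa using γ.integrable)
    (fun x _ => (hasFDerivAt_const (1 : ℂ) x).hasLineDerivAt v)
    (fun x _ => (γ.hasFDerivAt x).hasLineDerivAt v)
  simpa using this

theorem measurable_periodize (γ : SchwartzMap E ℂ) {ε : ℝ} (h0 : 0 < ε) (h1 : ε < 1) :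
    Measurable (periodize b γ ε) :=
  measurable_tsum_vadd (G := basisLattice b) (φ := fun x => γ (ε • x))
    (γ.continuous.comp (continuous_const_smul ε)).measurable
    (summable_norm_comp_smul b γ h0 h1)

theorem setIntegral_periodize (γ : SchwartzMap E ℂ) {ε : ℝ} (h0 : 0 < ε) (h1 : ε < 1) {D : Set E}
    (hD : IsAddFundamentalDomain (basisLattice b) D μ) (hfin : μ D ≠ ⊤) :
    ∫ x in D, periodize b γ ε x ∂μ = (ε ^ finrank ℝ E)⁻¹ • ∫ x, γ x ∂μ := by
  obtain ⟨C, -, hC⟩ := exists_tsum_norm_comp_smul_le b γ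
  have := integral_mul_eq_setIntegral_tsum hD (φ := fun x => γ (ε • x)) (u := fun _ => 1)
    (γ.continuous.comp (continuous_const_smul ε)).measurable
    (summable_norm_comp_smul b γ h0 h1) (hC ε h0 h1) (fun _ _ => rfl)
    (integrableOn_const hfin)
  simp only [mul_one] at this
  rw [← Measure.integral_comp_smul_of_nonneg μ _ ε (hR := h0.le), this]
  rfl

/-- The lattice sum of a slowly varying Schwartz function is constant to all orders. -/
theorem exists_norm_periodize_sub_integral_le {D : Set E} (hD : IsAddFundamentalDomain (basisLattice b) D μ)
    (n : ℕ) (γ : SchwartzMap E ℂ) :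
    ∃ C : ℝ, 0 < C ∧ ∀ ε : ℝ, 0 < ε → ε < 1 → ∀ x : E,
      ‖periodize b γ ε x - (ε ^ finrank ℝ E)⁻¹ • (μ.real D)⁻¹ • ∫ y, γ y ∂μ‖ ≤
        C * (ε ^ (finrank ℝ E + 1))⁻¹ * ε ^ n := by
  have hfin : μ D ≠ ⊤ := by
    rw [hD.measure_eq (ZSpan.isAddFundamentalDomain' b μ)]
    exact (ZSpan.fundamentalDomain_isBounded b).measure_lt_top.ne
  have hpos : 0 < μ.real D :=
    ENNReal.toReal_pos (hD.measure_ne_zero (NeZero.ne μ)) hfin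
  induction n generalizing γ with
  | zero =>
    obtain ⟨C, hC0, hC⟩ := exists_tsum_norm_comp_smul_le b γ
    refine ⟨C + ‖(μ.real D)⁻¹ • ∫ y, γ y ∂μ‖, by positivity, fun ε h0 h1 x => ?_⟩
    rw [pow_zero, mul_one, add_mul]
    refine (norm_sub_le _ _).trans (add_le_add ?_ ?_)
    · exact (norm_tsum_le_tsum_norm (summable_norm_comp_smul b γ h0 h1 x)).trans (hC ε h0 h1 x)
    · rw [norm_smul, mul_comm, Real.norm_of_nonneg (by positivity)]
      gcongr 1
      exact inv_anti₀ (by positivity) (pow_le_pow_of_le_one h0.le h1.le (Nat.le_succ _))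
  | succ n ih =>
    choose C hC0 hC using fun i => ih (∂_{b i} γ : SchwartzMap E ℂ)
    refine ⟨∑ i, C i + 1, add_pos_of_nonneg_of_pos
      (Finset.sum_nonneg fun i _ => (hC0 i).le) one_pos, fun ε h0 h1 x => ?_⟩
    set K : ℝ := (∑ i, C i + 1) * (ε ^ (finrank ℝ E + 1))⁻¹ * ε ^ (n + 1)
    have hosc (y : E) : ‖periodize b γ ε x - periodize b γ ε y‖ ≤ K := by
      refine (exists_norm_periodize_sub_le b γ h0 h1
        (K := fun i => C i * (ε ^ (finrank ℝ E + 1))⁻¹ * ε ^ n) (fun i z => ?_) x y).trans ?_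
      · simpa [integral_lineDerivOp_eq_zero] using hC i ε h0 h1 z
      · rw [← Finset.sum_mul, ← Finset.sum_mul]
        have : 0 < (ε ^ (finrank ℝ E + 1))⁻¹ * ε ^ (n + 1) := by positivity
        simp only [K, pow_succ ε n] at this ⊢
        linarith
    have hint : IntegrableOn (periodize b γ ε) D μ := by
      refine Measure.integrableOn_of_bounded (M := ‖periodize b γ ε x‖ + K) hfin
        (measurable_periodize b γ h0 h1).aestronglyMeasurable (.of_forall fun y => ?_)
      have h2 := norm_sub_norm_le (periodize b γ ε y) (periodize b γ ε x)
      rw [norm_sub_rev] at h2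
      linarith [hosc y]
    have hconst : IntegrableOn (fun _ : E => periodize b γ ε x) D μ := integrableOn_const hfin
    have hmean : periodize b γ ε x - (ε ^ finrank ℝ E)⁻¹ • (μ.real D)⁻¹ • ∫ y, γ y ∂μ =
        (μ.real D)⁻¹ • ∫ y in D, (periodize b γ ε x - periodize b γ ε y) ∂μ := by
      rw [integral_sub hconst hint, setIntegral_periodize b μ γ h0 h1 hD hfin,
        setIntegral_const, smul_sub, inv_smul_smul₀ hpos.ne', smul_comm]
    rw [hmean, norm_smul, Real.norm_of_nonneg (by positivity), inv_mul_le_iff₀ hpos, mul_comm]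
    exact norm_setIntegral_le_of_norm_le_const hfin.lt_top fun y _ => hosc y

theorem exists_norm_integral_mul_sub_le {D : Set E}
    (hD : IsAddFundamentalDomain (basisLattice b) D μ) (γ : SchwartzMap E ℂ) {u : E × ℝ → ℂ}
    (hper : ∀ R ∈ basisLattice b, ∀ x z, u (R + x, z) = u (x, z))
    (hint : IntegrableOn u (D ×ˢ Set.univ) (μ.prod volume)) (n : ℕ) :
    ∃ C : ℝ, 0 < C ∧ ∀ ε : ℝ, 0 < ε → ε < 1 →
      ‖(∫ p, γ (ε • p.1) * u p ∂(μ.prod volume)) - ((ε ^ finrank ℝ E)⁻¹ • (μ.real D)⁻¹ •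
        ∫ y, γ y ∂μ) * ∫ p in D ×ˢ Set.univ, u p ∂(μ.prod volume)‖ ≤ C * ε ^ n := by
  obtain ⟨C, hC0, hC⟩ :=
    exists_norm_periodize_sub_integral_le b μ hD (n + (finrank ℝ E + 1)) γ
  set D' : Set (E × ℝ) := D ×ˢ Set.univ with hD'
  set ν : Measure (E × ℝ) := μ.prod volume
  refine ⟨C * (∫ p in D', ‖u p‖ ∂ν) + 1, by positivity, fun ε h0 h1 => ?_⟩
  let e : basisLattice b ≃ (basisLattice b).prod (⊥ : AddSubgroup ℝ) :=
    { toFun R := ⟨(R, 0), R.2, rfl⟩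
      invFun g := ⟨g.1.1, g.2.1⟩
      left_inv _ := rfl
      right_inv := fun ⟨⟨_, z⟩, _, hz⟩ => Subtype.ext (Prod.ext rfl (Eq.symm hz)) }
  have : Countable ((basisLattice b).prod (⊥ : AddSubgroup ℝ)) := e.symm.injective.countable
  have hfd : IsAddFundamentalDomain ((basisLattice b).prod (⊥ : AddSubgroup ℝ)) D' ν := by
    rw [hD', Set.prod_univ]
    exact hD.preimage_of_equiv Measure.quasiMeasurePreserving_fst e.bijective fun R p => rfl
  obtain ⟨B, -, hB⟩ := exists_tsum_norm_comp_smul_le b γ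
  have hunfold := integral_mul_eq_setIntegral_tsum hfd (φ := fun p => γ (ε • p.1)) (u := u)
    (B := B * (ε ^ (finrank ℝ E + 1))⁻¹)
    (γ.continuous.comp (continuous_fst.const_smul ε)).measurable
    (fun p => e.summable_iff.1 (summable_norm_comp_smul b γ h0 h1 p.1))
    (fun p => (e.tsum_eq _).symm.trans_le (hB ε h0 h1 p.1))
    (fun g p => by
      obtain ⟨⟨R, z⟩, hR, hz⟩ := g
      obtain rfl : z = 0 := hz
      have hvadd : (R, (0 : ℝ)) + p = (R + p.1, p.2) := Prod.ext rfl (zero_add p.2)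
      exact (congrArg u hvadd).trans (hper R hR p.1 p.2)) hint
  have hperiodize (p : E × ℝ) : ∑' g : (basisLattice b).prod (⊥ : AddSubgroup ℝ),
      γ (ε • (g +ᵥ p).1) = periodize b γ ε p.1 := (e.tsum_eq _).symm
  simp only [hperiodize] at hunfold
  set m := (ε ^ finrank ℝ E)⁻¹ • (μ.real D)⁻¹ • ∫ y, γ y ∂μ
  have hdiff (p : E × ℝ) : ‖(periodize b γ ε p.1 - m) * u p‖ ≤ C * ε ^ n * ‖u p‖ := by
    rw [norm_mul]
    refine mul_le_mul_of_nonneg_right ((hC ε h0 h1 p.1).trans_eq ?_) (norm_nonneg _)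
    field_simp
    ring
  have hdint : IntegrableOn (fun p => (periodize b γ ε p.1 - m) * u p) D' ν :=
    (hint.norm.const_mul (C * ε ^ n)).mono'
      ((((measurable_periodize b γ h0 h1).comp measurable_fst).sub_const m).aestronglyMeasurable.mul
        hint.aestronglyMeasurable) (.of_forall hdiff)
  have hsplit : ∫ p in D', periodize b γ ε p.1 * u p ∂ν =
      (∫ p in D', (periodize b γ ε p.1 - m) * u p ∂ν) + m * ∫ p in D', u p ∂ν := by
    rw [← integral_const_mul, ← integral_add hdint (hint.const_mul m)]
    simp [sub_mul]
  rw [hunfold, hsplit, add_sub_cancel_right]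
  refine (norm_integral_le_of_norm_le (hint.norm.const_mul (C * ε ^ n))
    (.of_forall hdiff)).trans ?_
  rw [integral_const_mul]
  have : 0 < ε ^ n := by positivity
  linarith

end Periodization

section Graphene

theorem exists_basis_lat_eq {a0 : ℝ} (ha0 : 0 < a0) :
    ∃ b : Basis (Fin 2) ℝ Pt, lat a0 = basisLattice b := by
  have hli : LinearIndependent ℝ ![av1 a0, av2 a0] := by
    rw [LinearIndependent.pair_iff]
    intro s t h
    simp only [av1, av2, Prod.smul_mk, Prod.mk_add_mk, smul_eq_mul, Prod.mk_eq_zero] at h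
    obtain ⟨h1, h2⟩ := h
    have h3 : 0 < √3 := by positivity
    have e1 : s + t = 0 := by
      have : a0 * (s + t) = 0 := by linarith
      simpa [ha0.ne'] using this
    have e2 : t - s = 0 := by
      have : (√3 * a0) * (t - s) = 0 := by linarith
      simpa [ha0.ne', h3.ne'] using this
    constructor <;> linarith
  refine ⟨basisOfLinearIndependentOfCardEqFinrank hli (by simp), ?_⟩
  rw [basisLattice, coe_basisOfLinearIndependentOfCardEqFinrank,
    span_int_eq_addSubgroupClosure, Matrix.range_cons_cons_empty]
  rfl

end Graphene

end TwoScale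

/-- two-scale averaging lemma for a Schwartz envelope against an
𝕃-periodic function, with O(ε^∞) remainder. -/
theorem stmt0 (a0 : ℝ) (ha0 : 0 < a0) (Ω : Set Pt)
    (hΩ : IsAddFundamentalDomain (lat a0) Ω volume)
    (β : SchwartzMap Pt ℂ) (u : Pt → ℝ → ℂ)
    (hper : LPeriodic a0 u)
    (hint : IntegrableOn (fun p : Pt × ℝ => u p.1 p.2) (Ω ×ˢ (Set.univ : Set ℝ)) volume) :
    ∀ n : ℕ, ∃ C : ℝ, 0 < C ∧ ∃ ε₀ : ℝ, 0 < ε₀ ∧ ∀ ε : ℝ, 0 < ε → ε < ε₀ →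
      ‖(∫ p : Pt × ℝ, β (ε • p.1) * u p.1 p.2) -
          ((ε : ℂ) ^ 2)⁻¹ *
            ((((volume Ω).toReal : ℝ) : ℂ)⁻¹ * ∫ p in Ω ×ˢ (Set.univ : Set ℝ), u p.1 p.2) *
            (∫ X : Pt, β X)‖ ≤ C * ε ^ n := by
  intro n
  obtain ⟨b, hb⟩ := TwoScale.exists_basis_lat_eq ha0
  rw [hb] at hΩ
  obtain ⟨C, hC0, hC⟩ := TwoScale.exists_norm_integral_mul_sub_le b volume hΩ β
    (u := fun p => u p.1 p.2) (fun R hR x z => by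
      rw [add_comm]
      exact hper R (hb ▸ hR) x z) hint n
  refine ⟨C, hC0, 1, one_pos, fun ε h0 h1 => ?_⟩
  have h := hC ε h0 h1
  rw [← Measure.volume_eq_prod] at h
  convert h using 3
  simp only [Module.finrank_prod, Module.finrank_self, Measure.real, Complex.real_smul]
  push_cast
  ring
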